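/- Let R be a commutative ring and n ≥ 4. For every g in the exterior square group ⋀²GL_n(R) ≤ GL_N(R) (N = C(n,2)), every pair of 2-element subsets I ≠ J of {1,…,n} with |I ∩ J| = 1, and every pair of indices k ≠ l in {1,…,n}, the exterior transvection ⋀²t_{k,l}(g_{I,J}) can be written as a product of at most 8 matrices each of the form h^{-1}·g^{±1}·h with h ∈ ⋀²E_n(R). -/

import Mathlib

open Matrix

/-- Index set `⋀²[n]`: ordered pairs `(i₁,i₂)` with `i₁ < i₂`. -/
abbrev Pair (n : ℕ) := {p : Fin n × Fin n // p.1 < p.2}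

/-- The exterior square (second compound matrix): entries are the `2×2` minors. -/
def ext2 {R : Type*} [CommRing R] {n : ℕ} (x : Matrix (Fin n) (Fin n) R) :
    Matrix (Pair n) (Pair n) R :=
  fun I J => x I.1.1 J.1.1 * x I.1.2 J.1.2 - x I.1.1 J.1.2 * x I.1.2 J.1.1

/-- `sign(a,b) ∈ R`. -/
def sgn (R : Type*) [Ring R] {n : ℕ} (a b : Fin n) : R := if a < b then 1 else -1

/-- The entry `g_{{a,b},{c,d}}` of a matrix indexed by `⋀²[n]`, extended
skew-symmetrically to arbitrary (ordered) index pairs. -/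
def ent {R : Type*} [CommRing R] {n : ℕ} (g : Matrix (Pair n) (Pair n) R)
    (a b c d : Fin n) : R :=
  if h1 : a < b then
    if h2 : c < d then g ⟨(a, b), h1⟩ ⟨(c, d), h2⟩
    else if h2' : d < c then -g ⟨(a, b), h1⟩ ⟨(d, c), h2'⟩ else 0
  else if h1' : b < a then
    if h2 : c < d then -g ⟨(b, a), h1'⟩ ⟨(c, d), h2⟩
    else if h2' : d < c then g ⟨(b, a), h1'⟩ ⟨(d, c), h2'⟩ else 0
  else 0

/-- `A ∩ C ≠ ∅` for two elements `A, C` of `⋀²[n]`. -/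
def meets {n : ℕ} (A C : Pair n) : Prop :=
  A.1.1 = C.1.1 ∨ A.1.1 = C.1.2 ∨ A.1.2 = C.1.1 ∨ A.1.2 = C.1.2

/-- `a_{A,C}^H(g) = Σ_{B⊔D=H} sign(B,D)·g_{B,A}·g_{D,C}`, for `H = {h₁<h₂<h₃<h₄}`,
`A = {a,b}`, `C = {c,d}`: the sum over the six ordered partitions of `H` into
two-element subsets `B, D`, with the sign of the permutation sorting `(B,D)`. -/
def qsum {R : Type*} [CommRing R] {n : ℕ} (g : Matrix (Pair n) (Pair n) R)
    (h1 h2 h3 h4 a b c d : Fin n) : R :=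
  ent g h1 h2 a b * ent g h3 h4 c d - ent g h1 h3 a b * ent g h2 h4 c d
    + ent g h1 h4 a b * ent g h2 h3 c d + ent g h2 h3 a b * ent g h1 h4 c d
    - ent g h2 h4 a b * ent g h1 h3 c d + ent g h3 h4 a b * ent g h1 h2 c d

/-- The set of elementary transvections `t_{i,j}(ξ)`, `i ≠ j`, in `M_n(R)`. -/
def TransvSet (R : Type*) [CommRing R] (n : ℕ) : Set (Matrix (Fin n) (Fin n) R) :=
  {t | ∃ (i j : Fin n) (ξ : R), i ≠ j ∧ t = Matrix.transvection i j ξ}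

/-- `⋀²E_n(R)`: the image of the elementary group `E_n(R)` (the monoid generated by the
elementary transvections, which is a group since `t_{i,j}(ξ)⁻¹ = t_{i,j}(−ξ)`) under the
exterior square homomorphism. -/
def ExtE (R : Type*) [CommRing R] (n : ℕ) : Set (Matrix (Pair n) (Pair n) R) :=
  {m | ∃ x ∈ Submonoid.closure (TransvSet R n), m = ext2 x}

/-- `m` is an elementary exterior `g`-conjugate: `m = h⁻¹·g^{±1}·h` with `h ∈ ⋀²E_n(R)`
(here `g'` denotes the inverse of `g`). -/
def IsElemConj {R : Type*} [CommRing R] {n : ℕ}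
    (g g' m : Matrix (Pair n) (Pair n) R) : Prop :=
  ∃ h h' : Matrix (Pair n) (Pair n) R, h ∈ ExtE R n ∧ h * h' = 1 ∧ h' * h = 1 ∧
    (m = h' * g * h ∨ m = h' * g' * h)

/-- Membership in `⋀²GL_n(R)` (the group of `R`-points of the image of the group scheme
`GL_n` under the exterior square), characterized by the equations of
[LubNek18, Theorem 3]: `g` is invertible, `a_{A,C}^H(g) = 0` whenever `A ∩ C ≠ ∅`, and
`sign(A,C)·a_{A,C}^H(g)` depends only on `A ∪ C` for disjoint `A, C`. -/
structure MemExtGL {R : Type*} [CommRing R] {n : ℕ}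
    (g g' : Matrix (Pair n) (Pair n) R) : Prop where
  mul_inv : g * g' = 1
  inv_mul : g' * g = 1
  adjacent : ∀ h1 h2 h3 h4 : Fin n, h1 < h2 → h2 < h3 → h3 < h4 →
    ∀ a b c d : Fin n, a < b → c < d → (a = c ∨ a = d ∨ b = c ∨ b = d) →
      qsum g h1 h2 h3 h4 a b c d = 0
  nonadjacent : ∀ h1 h2 h3 h4 : Fin n, h1 < h2 → h2 < h3 → h3 < h4 →
    ∀ k1 k2 k3 k4 : Fin n, k1 < k2 → k2 < k3 → k3 < k4 →
      qsum g h1 h2 h3 h4 k1 k2 k3 k4 = - qsum g h1 h2 h3 h4 k1 k3 k2 k4 ∧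
      qsum g h1 h2 h3 h4 k1 k2 k3 k4 = qsum g h1 h2 h3 h4 k1 k4 k2 k3


/-- Skew extension of a vector indexed by `Pair n`. -/
def sk {R : Type*} [CommRing R] {n : ℕ} (w : Pair n → R) (a b : Fin n) : R :=
  if h : a < b then w ⟨(a, b), h⟩ else if h' : b < a then -w ⟨(b, a), h'⟩ else 0

section basics
variable {R : Type*} [CommRing R] {n : ℕ}

lemma sk_self (w : Pair n → R) (a : Fin n) : sk w a a = 0 := by simp [sk]

lemma sk_swap (w : Pair n → R) (a b : Fin n) : sk w a b = - sk w b a := by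
  rcases lt_trichotomy a b with h | h | h
  · simp [sk, h, h.not_gt]
  · subst h; simp [sk]
  · simp [sk, h, h.not_gt]

lemma sk_pair (w : Pair n → R) (A : Pair n) : sk w A.1.1 A.1.2 = w A := by
  simp [sk, A.2]

lemma sk_add (w z : Pair n → R) (a b : Fin n) : sk (w + z) a b = sk w a b + sk z a b := by
  unfold sk; split_ifs <;> simp <;> ring

lemma sk_smul (r : R) (w : Pair n → R) (a b : Fin n) : sk (r • w) a b = r * sk w a b := by
  unfold sk; split_ifs <;> simp

lemma sk_neg (w : Pair n → R) (a b : Fin n) : sk (-w) a b = - sk w a b := by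
  unfold sk; split_ifs <;> simp

lemma sk_sub (w z : Pair n → R) (a b : Fin n) : sk (w - z) a b = sk w a b - sk z a b := by
  rw [sub_eq_add_neg, sk_add, sk_neg, sub_eq_add_neg]

lemma sk_zero (a b : Fin n) : sk (0 : Pair n → R) a b = 0 := by
  unfold sk; split_ifs <;> simp

lemma sk_ext {w z : Pair n → R} (h : ∀ a b, sk w a b = sk z a b) : w = z := by
  funext A; rw [← sk_pair w, ← sk_pair z, h]

lemma pairsum_ite (G : Fin n → Fin n → R) :
    ∑ A : Pair n, G A.1.1 A.1.2 = ∑ p, ∑ q, if p < q then G p q else 0 := by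
  rw [← Fintype.sum_prod_type' (f := fun p q => if p < q then G p q else 0),
    ← Finset.sum_filter]
  exact (Finset.sum_subtype (Finset.univ.filter fun p : Fin n × Fin n => p.1 < p.2)
    (by simp) (fun p : Fin n × Fin n => G p.1 p.2)).symm

/-- Sums over all ordered index pairs against a skew function. -/
lemma pairsum (F : Fin n → Fin n → R) (w : Pair n → R) :
    ∑ p, ∑ q, F p q * sk w p q = ∑ A : Pair n, (F A.1.1 A.1.2 - F A.1.2 A.1.1) * w A := by
  have h1 : ∑ A : Pair n, (F A.1.1 A.1.2 - F A.1.2 A.1.1) * w A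
      = ∑ A : Pair n, (F A.1.1 A.1.2 * sk w A.1.1 A.1.2)
        + ∑ A : Pair n, (F A.1.2 A.1.1 * sk w A.1.2 A.1.1) := by
    rw [← Finset.sum_add_distrib]
    refine Finset.sum_congr rfl fun A _ => ?_
    rw [sk_swap w A.1.2, sk_pair]; ring
  rw [h1, pairsum_ite (fun p q => F p q * sk w p q), pairsum_ite (fun p q => F q p * sk w q p),
    Finset.sum_comm (f := fun p q => if p < q then F q p * sk w q p else 0),
    ← Finset.sum_add_distrib]
  refine Finset.sum_congr rfl fun p _ => ?_
  rw [← Finset.sum_add_distrib]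
  refine Finset.sum_congr rfl fun q _ => ?_
  rcases lt_trichotomy p q with h | h | h
  · simp [h, h.not_gt]
  · subst h; simp [sk_self]
  · simp [h, h.not_gt]

lemma sk_ext2_col (x : Matrix (Fin n) (Fin n) R) (A : Pair n) (a b : Fin n) :
    sk (fun P => ext2 x P A) a b = x a A.1.1 * x b A.1.2 - x a A.1.2 * x b A.1.1 := by
  unfold sk ext2
  split_ifs with h h'
  · rfl
  · simp; ring
  · obtain rfl : a = b := le_antisymm (not_lt.1 h') (not_lt.1 h)
    ring

lemma ext2_mul (x y : Matrix (Fin n) (Fin n) R) : ext2 (x * y) = ext2 x * ext2 y := by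
  ext I J
  rw [Matrix.mul_apply]
  have h := pairsum (fun p q => x I.1.1 p * x I.1.2 q) (fun P => ext2 y P J)
  have h2 : ∑ A : Pair n, ext2 x I A * ext2 y A J =
      ∑ A : Pair n, (x I.1.1 A.1.1 * x I.1.2 A.1.2 - x I.1.1 A.1.2 * x I.1.2 A.1.1) * ext2 y A J :=
    rfl
  rw [h2, ← h]
  simp only [sk_ext2_col]
  simp only [ext2, Matrix.mul_apply, Finset.sum_mul_sum]
  rw [← Finset.sum_sub_distrib]
  refine Finset.sum_congr rfl fun p _ => ?_
  rw [← Finset.sum_sub_distrib]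
  refine Finset.sum_congr rfl fun q _ => ?_
  ring

lemma ext2_one : ext2 (1 : Matrix (Fin n) (Fin n) R) = 1 := by
  ext I J
  obtain ⟨⟨a, b⟩, h⟩ := I
  obtain ⟨⟨c, d⟩, h'⟩ := J
  simp only [ext2, Matrix.one_apply, Subtype.mk.injEq, Prod.mk.injEq]
  simp only at h h'
  by_cases h1 : a = c <;> by_cases h2 : b = d <;> by_cases h3 : a = d <;> by_cases h4 : b = c <;>
    simp_all <;> grind

lemma sk_sum_smul {ι : Type*} (s : Finset ι) (f : ι → R) (v : ι → Pair n → R) (a b : Fin n) :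
    sk (∑ i ∈ s, f i • v i) a b = ∑ i ∈ s, f i * sk (v i) a b := by
  classical
  induction s using Finset.induction_on with
  | empty => simp [sk_zero]
  | insert i s hi ih => rw [Finset.sum_insert hi, Finset.sum_insert hi, sk_add, sk_smul, ih]

lemma mulVec_eq_sum' (g : Matrix (Pair n) (Pair n) R) (w : Pair n → R) :
    g *ᵥ w = ∑ A, w A • (fun P => g P A) := by
  funext P
  simp [Matrix.mulVec, dotProduct, mul_comm]

lemma sk_ext2_mulVec (x : Matrix (Fin n) (Fin n) R) (w : Pair n → R) (a b : Fin n) :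
    sk (ext2 x *ᵥ w) a b = ∑ p, ∑ q, x a p * x b q * sk w p q := by
  rw [mulVec_eq_sum', sk_sum_smul, pairsum]
  refine Finset.sum_congr rfl fun A _ => ?_
  rw [sk_ext2_col]; ring

/-- Action of a generalized transvection. -/
lemma sk_act (t : Matrix (Fin n) (Fin n) R) (x : Fin n → R) (i : Fin n)
    (ht : ∀ a p, t a p = (if a = p then 1 else 0) + x a * (if i = p then 1 else 0))
    (w : Pair n → R) (a b : Fin n) :
    sk (ext2 t *ᵥ w) a b = sk w a b + x a * sk w i b + x b * sk w a i := by
  rw [sk_ext2_mulVec]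
  simp only [ht, add_mul, mul_add, mul_assoc, Finset.sum_add_distrib,
    ite_mul, one_mul, zero_mul, Finset.sum_ite_eq, Finset.mem_univ, if_true, mul_ite, mul_zero,
    mul_one, sk_self]
  ring

lemma ent_eq (c : Matrix (Pair n) (Pair n) R) (a b p q : Fin n) :
    ent c a b p q = sk (fun P => sk (fun Q => c P Q) p q) a b := by
  unfold ent sk; split_ifs <;> simp

lemma ent_triple (g c : Matrix (Pair n) (Pair n) R) (a b p q : Fin n) :
    ent (g * c * gᵀ) a b p q =
      ∑ A, ∑ B, c A B * (sk (fun P => g P A) a b * sk (fun P => g P B) p q) := by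
  have h : ∀ P Q, (g * c * gᵀ) P Q = ∑ A, ∑ B, c A B * (g P A * g Q B) := by
    intro P Q
    simp only [Matrix.mul_apply, Matrix.transpose_apply, Finset.sum_mul]
    rw [Finset.sum_comm]
    refine Finset.sum_congr rfl fun A _ => Finset.sum_congr rfl fun B _ => ?_
    ring
  unfold ent sk
  split_ifs <;> simp [h]

/-- The map `M ⊗ M → ⋀⁴`. -/
def om (c : Matrix (Pair n) (Pair n) R) (a b p q : Fin n) : R :=
  ent c a b p q - ent c a p b q + ent c a q b p + ent c b p a q - ent c b q a p + ent c p q a b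

/-- `g` preserves the kernel of the map `M ⊗ M → ⋀⁴`. -/
def Good (g : Matrix (Pair n) (Pair n) R) : Prop :=
  ∀ c : Matrix (Pair n) (Pair n) R, (∀ a b p q, om c a b p q = 0) →
    ∀ a b p q, om (g * c * gᵀ) a b p q = 0

lemma Good.mul {g h : Matrix (Pair n) (Pair n) R} (hg : Good g) (hh : Good h) :
    Good (g * h) := by
  intro c hc
  have := hg _ (hh c hc)
  simpa [Matrix.transpose_mul, Matrix.mul_assoc] using this

lemma ent_ext2 (x : Matrix (Fin n) (Fin n) R) (c : Matrix (Pair n) (Pair n) R)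
    (a b p q : Fin n) :
    ent (ext2 x * c * (ext2 x)ᵀ) a b p q =
      ∑ a', ∑ b', ∑ p', ∑ q', x a a' * x b b' * x p p' * x q q' * ent c a' b' p' q' := by
  rw [ent_triple]
  simp only [sk_ext2_col]
  have h1 : ∀ a' b', ∑ p', ∑ q', x a a' * x b b' * x p p' * x q q' * ent c a' b' p' q'
      = x a a' * x b b' * sk (fun A => ∑ B : Pair n, c A B *
        (x p B.1.1 * x q B.1.2 - x p B.1.2 * x q B.1.1)) a' b' := by
    intro a' b'
    have : ∀ A : Pair n, ∑ B : Pair n, c A B * (x p B.1.1 * x q B.1.2 - x p B.1.2 * x q B.1.1)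
        = ∑ p', ∑ q', x p p' * x q q' * sk (fun B => c A B) p' q' := by
      intro A
      rw [pairsum]
      exact Finset.sum_congr rfl fun B _ => by ring
    simp only [this]
    have e : (fun A => ∑ p', ∑ q', x p p' * x q q' * sk (fun B => c A B) p' q') =
        ∑ z : Fin n × Fin n, (x p z.1 * x q z.2) • (fun A => sk (fun B => c A B) z.1 z.2) := by
      funext A
      simp [Fintype.sum_prod_type]
    rw [e, sk_sum_smul, Fintype.sum_prod_type, Finset.mul_sum]
    refine Finset.sum_congr rfl fun p' _ => ?_
    rw [Finset.mul_sum]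
    refine Finset.sum_congr rfl fun q' _ => ?_
    rw [ent_eq]; ring
  simp only [h1]
  rw [pairsum]
  refine Finset.sum_congr rfl fun A _ => ?_
  rw [Finset.mul_sum]
  refine Finset.sum_congr rfl fun B _ => ?_
  ring

lemma sw12 (F : Fin n → Fin n → Fin n → Fin n → R) :
    ∑ a, ∑ b, ∑ c, ∑ d, F b a c d = ∑ a, ∑ b, ∑ c, ∑ d, F a b c d := Finset.sum_comm

lemma sw23 (F : Fin n → Fin n → Fin n → Fin n → R) :
    ∑ a, ∑ b, ∑ c, ∑ d, F a c b d = ∑ a, ∑ b, ∑ c, ∑ d, F a b c d :=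
  Finset.sum_congr rfl fun _ _ => Finset.sum_comm

lemma sw34 (F : Fin n → Fin n → Fin n → Fin n → R) :
    ∑ a, ∑ b, ∑ c, ∑ d, F a b d c = ∑ a, ∑ b, ∑ c, ∑ d, F a b c d :=
  Finset.sum_congr rfl fun _ _ => Finset.sum_congr rfl fun _ _ => Finset.sum_comm

lemma sw_b (F : Fin n → Fin n → Fin n → Fin n → R) :
    ∑ a, ∑ b, ∑ c, ∑ d, F a d b c = ∑ a, ∑ b, ∑ c, ∑ d, F a b c d :=
  (sw34 fun a b c d => F a c b d).trans (sw23 F)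

lemma sw_c (F : Fin n → Fin n → Fin n → Fin n → R) :
    ∑ a, ∑ b, ∑ c, ∑ d, F b c a d = ∑ a, ∑ b, ∑ c, ∑ d, F a b c d :=
  (sw12 fun a b c d => F a c b d).trans (sw23 F)

lemma sw_d (F : Fin n → Fin n → Fin n → Fin n → R) :
    ∑ a, ∑ b, ∑ c, ∑ d, F b d a c = ∑ a, ∑ b, ∑ c, ∑ d, F a b c d :=
  (sw12 fun a b c d => F a d b c).trans (sw_b F)

lemma sw_e (F : Fin n → Fin n → Fin n → Fin n → R) :
    ∑ a, ∑ b, ∑ c, ∑ d, F c d a b = ∑ a, ∑ b, ∑ c, ∑ d, F a b c d :=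
  (sw23 fun a b c d => F b d a c).trans (sw_d F)

lemma good_ext2 (x : Matrix (Fin n) (Fin n) R) : Good (ext2 x) := by
  intro c hc a b p q
  have : om (ext2 x * c * (ext2 x)ᵀ) a b p q =
      ∑ a', ∑ b', ∑ p', ∑ q', x a a' * x b b' * x p p' * x q q' * om c a' b' p' q' := by
    unfold om
    simp only [ent_ext2]
    rw [← sw23 (fun a' b' p' q' => x a a' * x p b' * x b p' * x q q' * ent c a' b' p' q'),
      ← sw_b (fun a' b' p' q' => x a a' * x q b' * x b p' * x p q' * ent c a' b' p' q'),
      ← sw_c (fun a' b' p' q' => x b a' * x p b' * x a p' * x q q' * ent c a' b' p' q'),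
      ← sw_d (fun a' b' p' q' => x b a' * x q b' * x a p' * x p q' * ent c a' b' p' q'),
      ← sw_e (fun a' b' p' q' => x p a' * x q b' * x a p' * x b q' * ent c a' b' p' q')]
    simp only [← Finset.sum_add_distrib, ← Finset.sum_sub_distrib]
    refine Finset.sum_congr rfl fun a' _ => Finset.sum_congr rfl fun b' _ =>
      Finset.sum_congr rfl fun p' _ => Finset.sum_congr rfl fun q' _ => ?_
    ring
  rw [this]; simp [hc]

end basics

section good
variable {R : Type*} [CommRing R] {n : ℕ}

lemma om_swaps (c : Matrix (Pair n) (Pair n) R) (a b p q : Fin n) :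
    om c b a p q = - om c a b p q ∧ om c a p b q = - om c a b p q ∧
    om c a b q p = - om c a b p q := by
  have s1 : ∀ a b p q, ent c a b p q = - ent c b a p q := by
    intro a b p q; rw [ent_eq, ent_eq, sk_swap]
  have s2 : ∀ a b p q, ent c a b p q = - ent c a b q p := by
    intro a b p q; rw [ent_eq, ent_eq, ← sk_neg]
    congr 1; funext P; exact sk_swap _ _ _
  unfold om
  refine ⟨?_, ?_, ?_⟩
  · rw [s1 b a p q, s2 p q b a]; ring
  · rw [s1 p b a q, s2 a q p b]; ring
  · rw [s2 a b q p, s1 q p a b]; ring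

lemma om_diag (c : Matrix (Pair n) (Pair n) R) (a p q : Fin n) :
    om c a a p q = 0 ∧ om c p a a q = 0 ∧ om c p q a a = 0 := by
  have s1 : ∀ a b p q, ent c a b p q = - ent c b a p q := by
    intro a b p q; rw [ent_eq, ent_eq, sk_swap]
  have s2 : ∀ a b p q, ent c a b p q = - ent c a b q p := by
    intro a b p q; rw [ent_eq, ent_eq, ← sk_neg]
    congr 1; funext P; exact sk_swap _ _ _
  have z1 : ∀ a p q, ent c a a p q = 0 := by intro a p q; rw [ent_eq, sk_self]
  have z2 : ∀ a p q, ent c p q a a = 0 := by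
    intro a p q; rw [ent_eq]; simp only [sk_self]; exact sk_zero _ _
  unfold om
  refine ⟨?_, ?_, ?_⟩
  · rw [z1, z2]; ring
  · rw [z1, z2, s1 a q p a, s2 p a a q]; ring
  · rw [z1, z2]; ring

lemma alt_vanish (W : Fin n → Fin n → Fin n → Fin n → R)
    (h1 : ∀ a b p q, W b a p q = - W a b p q) (h2 : ∀ a b p q, W a p b q = - W a b p q)
    (h3 : ∀ a b p q, W a b q p = - W a b p q)
    (d1 : ∀ a p q, W a a p q = 0) (d2 : ∀ a p q, W p a a q = 0) (d3 : ∀ a p q, W p q a a = 0)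
    (hs : ∀ a b p q, a < b → b < p → p < q → W a b p q = 0) (a b p q : Fin n) :
    W a b p q = 0 := by
  have A : ∀ a b p q, a < b → b < p → W a b p q = 0 := by
    intro a b p q hab hbp
    rcases lt_trichotomy p q with h | h | h
    · exact hs _ _ _ _ hab hbp h
    · rw [h]; exact d3 _ _ _
    rw [h3, neg_eq_zero]
    rcases lt_trichotomy b q with h' | h' | h'
    · exact hs _ _ _ _ hab h' h
    · rw [h']; exact d2 _ _ _
    rw [h2, neg_eq_zero]
    rcases lt_trichotomy a q with h' | h' | h'
    · exact hs _ _ _ _ h' ‹_› hbp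
    · rw [h']; exact d1 _ _ _
    rw [h1, neg_eq_zero]
    exact hs _ _ _ _ h' hab hbp
  have B : ∀ a b p q, a < b → W a b p q = 0 := by
    intro a b p q hab
    rcases lt_trichotomy b p with h | h | h
    · exact A _ _ _ _ hab h
    · rw [h]; exact d2 _ _ _
    rw [h2, neg_eq_zero]
    rcases lt_trichotomy a p with h' | h' | h'
    · exact A _ _ _ _ h' h
    · rw [h']; exact d1 _ _ _
    rw [h1, neg_eq_zero]
    exact A _ _ _ _ h' hab
  rcases lt_trichotomy a b with h | h | h
  · exact B _ _ _ _ h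
  · rw [h]; exact d1 _ _ _
  · rw [h1, neg_eq_zero]; exact B _ _ _ _ h

lemma om_vanish (c : Matrix (Pair n) (Pair n) R)
    (hs : ∀ a b p q, a < b → b < p → p < q → om c a b p q = 0) (a b p q : Fin n) :
    om c a b p q = 0 :=
  alt_vanish (om c) (fun a b p q => (om_swaps c a b p q).1) (fun a b p q => (om_swaps c a b p q).2.1)
    (fun a b p q => (om_swaps c a b p q).2.2) (fun a p q => (om_diag c a p q).1)
    (fun a p q => (om_diag c a p q).2.1) (fun a p q => (om_diag c a p q).2.2) hs a b p q

lemma ent_col (g : Matrix (Pair n) (Pair n) R) (A : Pair n) (a b : Fin n) :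
    ent g a b A.1.1 A.1.2 = sk (fun P => g P A) a b := by
  rw [ent_eq]; congr 1; funext P; exact sk_pair _ _

lemma om_triple (g c : Matrix (Pair n) (Pair n) R) (a b p q : Fin n) :
    om (g * c * gᵀ) a b p q =
      ∑ A : Pair n, ∑ B : Pair n, c A B * qsum g a b p q A.1.1 A.1.2 B.1.1 B.1.2 := by
  unfold om qsum
  simp only [ent_triple, ent_col]
  simp only [← Finset.sum_add_distrib, ← Finset.sum_sub_distrib]
  refine Finset.sum_congr rfl fun A _ => Finset.sum_congr rfl fun B _ => ?_
  ring

lemma regroup (α : Fin n → Fin n → Fin n → Fin n → R) (hsym : ∀ a b d e, α a b d e = α d e a b)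
    (hadj : ∀ a b d e, a < b → d < e → (a = d ∨ a = e ∨ b = d ∨ b = e) → α a b d e = 0)
    (hnon : ∀ a b d e, a < b → b < d → d < e →
      α a b d e = - α a d b e ∧ α a b d e = α a e b d)
    (c : Matrix (Pair n) (Pair n) R) :
    ∑ A : Pair n, ∑ B : Pair n, c A B * α A.1.1 A.1.2 B.1.1 B.1.2 =
      ∑ a, ∑ b, ∑ d, ∑ e, (if a < b ∧ b < d ∧ d < e then α a b d e else 0) * om c a b d e := by
  set S : Fin n → Fin n → Fin n → Fin n → R :=
    fun a b d e => if a < b ∧ b < d ∧ d < e then α a b d e else 0 with hS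
  have h1 : ∑ A : Pair n, ∑ B : Pair n, c A B * α A.1.1 A.1.2 B.1.1 B.1.2 =
      ∑ a, ∑ b, ∑ d, ∑ e, if a < b ∧ d < e then ent c a b d e * α a b d e else 0 := by
    have e1 : ∀ A : Pair n, ∑ B : Pair n, c A B * α A.1.1 A.1.2 B.1.1 B.1.2 =
        ∑ d, ∑ e, if d < e then ent c A.1.1 A.1.2 d e * α A.1.1 A.1.2 d e else 0 := by
      intro A
      rw [← pairsum_ite (fun d e => ent c A.1.1 A.1.2 d e * α A.1.1 A.1.2 d e)]
      refine Finset.sum_congr rfl fun B _ => ?_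
      rw [ent_col, sk_pair]
    simp only [e1]
    rw [pairsum_ite (fun a b => ∑ d, ∑ e, if d < e then ent c a b d e * α a b d e else 0)]
    refine Finset.sum_congr rfl fun a _ => Finset.sum_congr rfl fun b _ => ?_
    by_cases hab : a < b <;> simp [hab]
  have h2 : ∀ a b d e, (if a < b ∧ d < e then ent c a b d e * α a b d e else 0) =
      ent c a b d e * S a b d e - ent c a b d e * S a d b e + ent c a b d e * S a d e b
      + ent c a b d e * S d a b e - ent c a b d e * S d a e b + ent c a b d e * S d e a b := by
    intro a b d e
    have : (if a < b ∧ d < e then α a b d e else 0) =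
      S a b d e - S a d b e + S a d e b + S d a b e - S d a e b + S d e a b := by
      by_cases hab : a < b
      swap
      · have : ¬ (a < d ∧ d < b) := fun h => hab (h.1.trans h.2)
        simp only [hS]; grind
      by_cases hde : d < e
      swap
      · simp only [hS]; grind
      by_cases hm : a = d ∨ a = e ∨ b = d ∨ b = e
      · rw [hadj a b d e hab hde hm]; simp only [hS]; grind
      · simp only [hS]
        have n1 := hnon a b d e
        have n2 := hnon a d b e
        have n3 := hnon a d e b
        have n4 := hnon d a b e
        have n5 := hnon d a e b
        have n6 := hnon d e a b
        have s1 := hsym a b d e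
        grind
    have e2 : (if a < b ∧ d < e then ent c a b d e * α a b d e else 0) =
      ent c a b d e * (if a < b ∧ d < e then α a b d e else 0) := by split_ifs <;> simp
    rw [e2, this]; ring
  rw [h1]
  simp only [h2, Finset.sum_add_distrib, Finset.sum_sub_distrib]
  rw [← sw23 (fun a b d e => ent c a b d e * S a d b e),
    ← sw_b (fun a b d e => ent c a b d e * S a d e b),
    ← sw_c (fun a b d e => ent c a b d e * S d a b e),
    ← sw_d (fun a b d e => ent c a b d e * S d a e b),
    ← sw_e (fun a b d e => ent c a b d e * S d e a b)]
  simp only [← Finset.sum_add_distrib, ← Finset.sum_sub_distrib]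
  refine Finset.sum_congr rfl fun a _ => Finset.sum_congr rfl fun b _ =>
    Finset.sum_congr rfl fun d _ => Finset.sum_congr rfl fun e _ => ?_
  unfold om; ring

lemma MemExtGL.good {g g' : Matrix (Pair n) (Pair n) R} (hg : MemExtGL g g') : Good g := by
  intro c hc
  apply om_vanish
  intro a b p q hab hbp hpq
  rw [om_triple, regroup (fun x y z t => qsum g a b p q x y z t)]
  · simp [hc]
  · intro x y z t; unfold qsum; ring
  · intro x y z t h1 h2 h3; exact hg.adjacent _ _ _ _ hab hbp hpq _ _ _ _ h1 h2 h3
  · intro x y z t h1 h2 h3; exact hg.nonadjacent _ _ _ _ hab hbp hpq _ _ _ _ h1 h2 h3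

lemma ent_add (c d : Matrix (Pair n) (Pair n) R) (a b p q : Fin n) :
    ent (c + d) a b p q = ent c a b p q + ent d a b p q := by
  unfold ent; split_ifs <;> simp <;> ring

lemma ent_smul (r : R) (c : Matrix (Pair n) (Pair n) R) (a b p q : Fin n) :
    ent (r • c) a b p q = r * ent c a b p q := by
  unfold ent; split_ifs <;> simp

/-- The kernel of `M ⊗ M → ⋀⁴`. -/
def omKer (R : Type*) [CommRing R] (n : ℕ) : Submodule R (Matrix (Pair n) (Pair n) R) where
  carrier := {c | ∀ a b p q, om c a b p q = 0}
  add_mem' := by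
    intro c d hc hd a b p q
    have h1 := hc a b p q
    have h2 := hd a b p q
    unfold om at *
    simp only [ent_add]
    linear_combination h1 + h2
  zero_mem' := by
    intro a b p q
    have : ∀ a b p q, ent (0 : Matrix (Pair n) (Pair n) R) a b p q = 0 := by
      intro a b p q; unfold ent; simp
    unfold om; simp [this]
  smul_mem' := by
    intro r c hc a b p q
    have h1 := hc a b p q
    unfold om at *
    simp only [ent_smul]
    linear_combination r * h1

/-- Conjugation action on tensors. -/
def tact (g : Matrix (Pair n) (Pair n) R) :
    Matrix (Pair n) (Pair n) R →ₗ[R] Matrix (Pair n) (Pair n) R where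
  toFun c := g * c * gᵀ
  map_add' c d := by simp [Matrix.mul_add, Matrix.add_mul]
  map_smul' r c := by simp

lemma Good.inv {g g' : Matrix (Pair n) (Pair n) R} (hg : Good g) (h1 : g * g' = 1) :
    Good g' := by
  have hle : omKer R n ≤ (omKer R n).comap (tact g) := fun c hc => hg c hc
  have hT : g * g' = 1 → ∀ c, tact g (tact g' c) = c := by
    intro h c
    have h' : g'ᵀ * gᵀ = 1 := by rw [← Matrix.transpose_mul, h, Matrix.transpose_one]
    change g * (g' * c * g'ᵀ) * gᵀ = c
    calc g * (g' * c * g'ᵀ) * gᵀ = (g * g') * c * (g'ᵀ * gᵀ) := by simp only [Matrix.mul_assoc]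
      _ = c := by rw [h, h']; simp
  let f := (omKer R n).mapQ (omKer R n) (tact g) hle
  have hsurj : Function.Surjective f := by
    intro y
    obtain ⟨c, rfl⟩ := Submodule.mkQ_surjective _ y
    refine ⟨(omKer R n).mkQ (tact g' c), ?_⟩
    simp only [f, Submodule.mkQ_apply, Submodule.mapQ_apply, hT h1]
  have hinj : Function.Injective f := OrzechProperty.injective_of_surjective_endomorphism f hsurj
  intro c hc
  have : f ((omKer R n).mkQ (tact g' c)) = f 0 := by
    simp only [f, Submodule.mkQ_apply, Submodule.mapQ_apply, hT h1, map_zero]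
    exact (Submodule.Quotient.mk_eq_zero _).2 hc
  exact (Submodule.Quotient.mk_eq_zero _).1 (hinj this)

end good

section comm
variable {R : Type*} [CommRing R] {n : ℕ}

/-- Components of the wedge product of two bivectors. -/
def wd (y z : Pair n → R) (a b p q : Fin n) : R :=
  sk y a b * sk z p q - sk y a p * sk z b q + sk y a q * sk z b p
    + sk y b p * sk z a q - sk y b q * sk z a p + sk y p q * sk z a b

lemma om_vecMulVec (y z : Pair n → R) (a b p q : Fin n) :
    om (Matrix.vecMulVec y z) a b p q = wd y z a b p q := by
  have : ∀ a b p q, ent (Matrix.vecMulVec y z) a b p q = sk y a b * sk z p q := by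
    intro a b p q
    unfold ent sk
    split_ifs <;> simp [Matrix.vecMulVec_apply]
  unfold om wd; simp only [this]

lemma Good.wd {X : Matrix (Pair n) (Pair n) R} (hX : Good X) {y z : Pair n → R}
    (h : ∀ a b p q, wd y z a b p q = 0) (a b p q : Fin n) :
    wd (X *ᵥ y) (X *ᵥ z) a b p q = 0 := by
  have := hX (Matrix.vecMulVec y z) (fun a b p q => by rw [om_vecMulVec, h]) a b p q
  rwa [Matrix.mul_vecMulVec, Matrix.vecMulVec_mul, Matrix.vecMul_transpose, om_vecMulVec] at this

/-- The decomposable bivector `e_a ∧ e_b`. -/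
def ev (R : Type*) [CommRing R] {n : ℕ} (a b : Fin n) : Pair n → R := fun P =>
  (if P.1.1 = a then 1 else 0) * (if P.1.2 = b then 1 else 0)
    - (if P.1.1 = b then 1 else 0) * (if P.1.2 = a then 1 else 0)

lemma sk_ev (a b p q : Fin n) : sk (ev R a b) p q =
    (if p = a then 1 else 0) * (if q = b then 1 else 0)
    - (if p = b then 1 else 0) * (if q = a then 1 else 0) := by
  unfold sk ev
  split_ifs with h h' <;> first | simp | skip
  all_goals grind

lemma ev_swap (a b : Fin n) : ev R a b = - ev R b a := by
  funext P; simp [ev]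

lemma ev_pair (A : Pair n) : ev R A.1.1 A.1.2 = Pi.single A 1 := by
  funext P
  obtain ⟨⟨a, b⟩, h⟩ := A
  obtain ⟨⟨c, d⟩, h'⟩ := P
  simp only at h h'
  simp only [ev, Pi.single_apply, Subtype.mk.injEq, Prod.mk.injEq]
  grind

lemma sk_transv (i c : Fin n) (w : Pair n → R) (a b : Fin n) :
    sk (ext2 (Matrix.transvection i c 1) *ᵥ w) a b =
      sk w a b + (if a = i then 1 else 0) * sk w c b + (if b = i then 1 else 0) * sk w a c := by
  apply sk_act (Matrix.transvection i c 1) (fun a => if a = i then 1 else 0) c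
  intro a p
  simp only [Matrix.transvection, Matrix.add_apply, Matrix.one_apply, Matrix.single_apply]
  grind

/-- Bivectors annihilated by `e_i ∧ e_j`. -/
def F2 (i j : Fin n) (y : Pair n → R) : Prop :=
  ∀ p q, p ≠ i → p ≠ j → q ≠ i → q ≠ j → sk y p q = 0

lemma F2_wd {i j : Fin n} (hij : i ≠ j) (y : Pair n → R) :
    F2 i j y ↔ ∀ a b p q, wd y (ev R i j) a b p q = 0 := by
  constructor
  · intro h a b p q
    have s := fun a b => sk_swap y a b
    have z := fun a => sk_self y a
    unfold wd
    simp only [sk_ev]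
    unfold F2 at h
    grind
  · intro h p q h1 h2 h3 h4
    have := h i j p q
    unfold wd at this
    simp only [sk_ev] at this
    simpa [h1, h2, h3, h4, hij, hij.symm, h1.symm, h2.symm] using this

lemma Good.F2 {X : Matrix (Pair n) (Pair n) R} (hX : Good X) {i j : Fin n} (hij : i ≠ j)
    (he : X *ᵥ ev R i j = ev R i j) {y : Pair n → R} (hy : F2 i j y) : F2 i j (X *ᵥ y) := by
  rw [F2_wd hij] at hy ⊢
  have := hX.wd hy
  rwa [he] at this

lemma transv_F2 {i j c : Fin n} (hij : i ≠ j) (hic : i ≠ c) (hjc : j ≠ c) {y : Pair n → R}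
    (hy : F2 i j y) :
    ext2 (Matrix.transvection i c 1) *ᵥ y = y - sk y j c • ev R i j := by
  apply sk_ext
  intro p q
  rw [sk_transv, sk_sub, sk_smul, sk_ev]
  have s := fun a b => sk_swap y a b
  have z := fun a => sk_self y a
  unfold F2 at hy
  grind

lemma F2_ev_left {i j b : Fin n} : F2 i j (ev R i b) := by
  intro p q h1 h2 h3 h4
  rw [sk_ev]; simp [h1, h3]

lemma F2_ev_right {i j b : Fin n} : F2 i j (ev R j b) := by
  intro p q h1 h2 h3 h4
  rw [sk_ev]; simp [h2, h4]

lemma F2_swap {i j : Fin n} {y : Pair n → R} (h : F2 i j y) : F2 j i y :=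
  fun p q h1 h2 h3 h4 => h p q h2 h1 h4 h3

lemma F2.neg {i j : Fin n} {y : Pair n → R} (h : F2 i j y) : F2 i j (-y) := by
  intro p q h1 h2 h3 h4
  rw [sk_neg, h p q h1 h2 h3 h4, neg_zero]

/-- Commutation of `v` with an abstract element `H` acting unipotently on the flag. -/
lemma comm_abs {i j c : Fin n} (hij : i ≠ j) (hic : i ≠ c) (hjc : j ≠ c)
    {H : Matrix (Pair n) (Pair n) R} (hH : Good H) (he : H *ᵥ ev R i j = ev R i j)
    (h2 : ∀ y, F2 i j y → ∃ κ : R, H *ᵥ y = y + κ • ev R i j)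
    (h3 : ∀ y, F2 i j (H *ᵥ y - y)) :
    ext2 (Matrix.transvection i c 1) * H = H * ext2 (Matrix.transvection i c 1) := by
  set V := ext2 (Matrix.transvection i c (1 : R)) with hV
  have hVe : V *ᵥ ev R i j = ev R i j := by
    rw [hV, transv_F2 hij hic hjc F2_ev_left, sk_ev]
    simp [hij.symm, hic.symm]
  have hF : ∀ y, F2 i j y → V *ᵥ (H *ᵥ y) = H *ᵥ (V *ᵥ y) := by
    intro y hy
    obtain ⟨κ, hκ⟩ := h2 y hy
    rw [hκ, Matrix.mulVec_add, Matrix.mulVec_smul, hVe, hV, transv_F2 hij hic hjc hy,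
      Matrix.mulVec_sub, Matrix.mulVec_smul, he, hκ]
    abel
  -- the coefficient relation
  have key : ∀ a b, a ≠ i → a ≠ j → b ≠ i → b ≠ j → a ≠ b → ∀ κ : R,
      H *ᵥ ev R i a = ev R i a + κ • ev R i j → ∀ q, q ≠ i → q ≠ j → q ≠ a →
        sk (H *ᵥ ev R a b) j q = if q = b then κ else 0 := by
    intro a b hai haj hbi hbj hab κ hκ q hqi hqj hqa
    have w0 : ∀ x y p q, wd (ev R i a) (ev R a b) x y p q = 0 := by
      intro x y p q
      unfold wd; simp only [sk_ev]
      ring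
    have w := hH.wd w0 i j a q
    rw [hκ] at w
    have hs := h3 (ev R a b) a q hai haj hqi hqj
    rw [sk_sub, sk_ev] at hs
    unfold wd at w
    simp only [sk_add, sk_smul, sk_ev] at w
    simp [hij, hij.symm, hai, haj, hbi, hbj, hab, hab.symm, hqi, hqj, hqa, hai.symm, haj.symm, hqi.symm] at w hs
    grind
  -- the essential case
  have hE : ∀ a b, a ≠ i → a ≠ j → b ≠ i → b ≠ j → a ≠ b → c ≠ a →
      V *ᵥ (H *ᵥ ev R a b) = H *ᵥ (V *ᵥ ev R a b) := by
    intro a b hai haj hbi hbj hab hca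
    obtain ⟨κ, hκ⟩ := h2 (ev R i a) F2_ev_left
    have hk := key a b hai haj hbi hbj hab κ hκ c hic.symm hjc.symm hca
    have hVy : V *ᵥ ev R a b = ev R a b - (if c = b then (1 : R) else 0) • ev R i a := by
      apply sk_ext
      intro p q
      rw [hV, sk_transv, sk_sub, sk_smul]
      simp only [sk_ev]
      simp only [if_neg hca]
      ring
    have hs : H *ᵥ ev R a b = ev R a b + (H *ᵥ ev R a b - ev R a b) := by abel
    have hsj : sk (H *ᵥ ev R a b - ev R a b) j c = if c = b then κ else 0 := by
      rw [sk_sub, hk, sk_ev]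
      simp [haj.symm, hbj.symm]
    have l : V *ᵥ (H *ᵥ ev R a b) = V *ᵥ ev R a b +
        ((H *ᵥ ev R a b - ev R a b) - (if c = b then κ else 0) • ev R i j) := by
      conv_lhs => rw [hs]
      rw [Matrix.mulVec_add, ← hsj, ← transv_F2 hij hic hjc (h3 (ev R a b))]
    rw [l, hVy, Matrix.mulVec_sub, Matrix.mulVec_smul, hκ]
    split_ifs
    · simp only [one_smul]; abel
    · simp only [zero_smul]; abel
  -- all basis vectors
  have hall : ∀ a b, V *ᵥ (H *ᵥ ev R a b) = H *ᵥ (V *ᵥ ev R a b) := by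
    intro a b
    by_cases hab : a = b
    · have : ev R a b = 0 := by subst hab; funext P; simp [ev]
      rw [this]; simp
    by_cases hai : a = i
    · subst hai; exact hF _ F2_ev_left
    by_cases haj : a = j
    · subst haj; exact hF _ F2_ev_right
    by_cases hbi : b = i
    · subst hbi; rw [ev_swap]; exact hF _ F2_ev_left.neg
    by_cases hbj : b = j
    · subst hbj; rw [ev_swap]; exact hF _ F2_ev_right.neg
    by_cases hca : c = a
    · rw [ev_swap]
      simp only [Matrix.mulVec_neg]
      rw [hE b a hbi hbj hai haj (Ne.symm hab) (by rw [hca]; exact hab)]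
    · exact hE a b hai haj hbi hbj hab hca
  apply Matrix.ext_of_mulVec_single
  intro A
  rw [← ev_pair, ← Matrix.mulVec_mulVec, ← Matrix.mulVec_mulVec]
  exact hall _ _

lemma comm_main {i j c : Fin n} (hij : i ≠ j) (hic : i ≠ c) (hjc : j ≠ c)
    {X X' : Matrix (Pair n) (Pair n) R} (hX : Good X) (hX' : Good X') (h1 : X * X' = 1)
    (h2 : X' * X = 1) (he : X *ᵥ ev R i j = ev R i j) :
    ext2 (Matrix.transvection i c 1) * (X * ext2 (Matrix.transvection j c 1) * X') =
      (X * ext2 (Matrix.transvection j c 1) * X') * ext2 (Matrix.transvection i c 1) := by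
  have he' : X' *ᵥ ev R i j = ev R i j := by
    conv_lhs => rw [← he]
    rw [Matrix.mulVec_mulVec, h2, Matrix.one_mulVec]
  set U := ext2 (Matrix.transvection j c (1 : R)) with hU
  have hUF : ∀ y, F2 i j y → ∃ κ : R, U *ᵥ y = y + κ • ev R i j := by
    intro y hy
    refine ⟨sk y i c, ?_⟩
    rw [hU, transv_F2 hij.symm hjc hic (F2_swap hy), ev_swap]
    simp
  have hXX : ∀ y, X *ᵥ (X' *ᵥ y) = y := by
    intro y; rw [Matrix.mulVec_mulVec, h1, Matrix.one_mulVec]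
  have hdiff : ∀ y, (X * U * X') *ᵥ y = y + X *ᵥ (U *ᵥ (X' *ᵥ y) - X' *ᵥ y) := by
    intro y
    rw [Matrix.mulVec_sub, hXX, ← Matrix.mulVec_mulVec, ← Matrix.mulVec_mulVec]
    abel
  have h2' : ∀ y, F2 i j y → ∃ κ : R, (X * U * X') *ᵥ y = y + κ • ev R i j := by
    intro y hy
    obtain ⟨κ, hκ⟩ := hUF _ (hX'.F2 hij he' hy)
    refine ⟨κ, ?_⟩
    rw [hdiff, hκ, add_sub_cancel_left, Matrix.mulVec_smul, he]
  refine comm_abs hij hic hjc ((hX.mul (good_ext2 _)).mul hX') ?_ h2' ?_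
  · have hUe : U *ᵥ ev R i j = ev R i j := by
      rw [hU, transv_F2 hij.symm hjc hic F2_ev_right, sk_ev]
      simp [hij, hjc.symm]
    rw [hdiff, he', hUe, sub_self, Matrix.mulVec_zero, add_zero]
  · intro y
    rw [hdiff, add_sub_cancel_left]
    apply hX.F2 hij he
    intro p q hp1 hp2 hq1 hq2
    rw [sk_sub, hU, sk_transv]
    simp [hp2, hq2]

end comm

section groups
variable {R : Type*} [CommRing R] {n : ℕ}

/-- The exterior square as a monoid homomorphism. -/
def ext2Hom (R : Type*) [CommRing R] (n : ℕ) :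
    Matrix (Fin n) (Fin n) R →* Matrix (Pair n) (Pair n) R where
  toFun := ext2
  map_one' := ext2_one
  map_mul' := ext2_mul

/-- The exterior square on unit groups. -/
def phi (R : Type*) [CommRing R] (n : ℕ) :
    (Matrix (Fin n) (Fin n) R)ˣ →* (Matrix (Pair n) (Pair n) R)ˣ := Units.map (ext2Hom R n)

lemma phi_val (x : (Matrix (Fin n) (Fin n) R)ˣ) : (phi R n x).val = ext2 x.val := rfl

/-- The elementary group. -/
def EU (R : Type*) [CommRing R] (n : ℕ) : Subgroup (Matrix (Fin n) (Fin n) R)ˣ where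
  carrier := {x | x.val ∈ Submonoid.closure (TransvSet R n) ∧
    (x⁻¹).val ∈ Submonoid.closure (TransvSet R n)}
  mul_mem' := by
    intro x y hx hy
    refine ⟨?_, ?_⟩
    · rw [Units.val_mul]; exact mul_mem hx.1 hy.1
    · rw [_root_.mul_inv_rev, Units.val_mul]; exact mul_mem hy.2 hx.2
  one_mem' := by simp
  inv_mem' := by
    intro x hx
    exact ⟨hx.2, by rw [inv_inv]; exact hx.1⟩

/-- Generalized transvection `1 + x ⊗ e_i^*`. -/
def gt (x : Fin n → R) (i : Fin n) (hx : x i = 0) : (Matrix (Fin n) (Fin n) R)ˣ where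
  val := 1 + Matrix.vecMulVec x (Pi.single i 1)
  inv := 1 + Matrix.vecMulVec (-x) (Pi.single i 1)
  val_inv := by
    have : Matrix.vecMulVec x (Pi.single i 1) * Matrix.vecMulVec x (Pi.single i 1) = 0 := by
      rw [Matrix.vecMulVec_mul_vecMulVec]; simp [hx]
    simp [Matrix.neg_vecMulVec, mul_add, add_mul, this]
  inv_val := by
    have : Matrix.vecMulVec x (Pi.single i 1) * Matrix.vecMulVec x (Pi.single i 1) = 0 := by
      rw [Matrix.vecMulVec_mul_vecMulVec]; simp [hx]
    simp [Matrix.neg_vecMulVec, mul_add, add_mul, this]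

/-- Elementary transvections as units. -/
def tu (i j : Fin n) (h : i ≠ j) (r : R) : (Matrix (Fin n) (Fin n) R)ˣ where
  val := Matrix.transvection i j r
  inv := Matrix.transvection i j (-r)
  val_inv := by rw [Matrix.transvection_mul_transvection_same _ _ h]; simp
  inv_val := by rw [Matrix.transvection_mul_transvection_same _ _ h]; simp

lemma tu_mem (i j : Fin n) (h : i ≠ j) (r : R) : tu i j h r ∈ EU R n :=
  ⟨Submonoid.subset_closure ⟨i, j, r, h, rfl⟩, Submonoid.subset_closure ⟨i, j, -r, h, rfl⟩⟩

lemma gt_closure (x : Fin n → R) (i : Fin n) (hx : x i = 0) :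
    1 + Matrix.vecMulVec x (Pi.single i 1) ∈ Submonoid.closure (TransvSet R n) := by
  have h : ∀ s : Finset (Fin n), i ∉ s →
      1 + ∑ k ∈ s, Matrix.single k i (x k) ∈ Submonoid.closure (TransvSet R n) := by
    intro s
    induction s using Finset.induction_on with
    | empty => intro _; simp
    | insert k s hk ih =>
      intro hi
      rw [Finset.mem_insert, not_or] at hi
      have e : 1 + ∑ k ∈ insert k s, Matrix.single k i (x k) =
          Matrix.transvection k i (x k) * (1 + ∑ k ∈ s, Matrix.single k i (x k)) := by
        rw [Finset.sum_insert hk, Matrix.transvection, add_mul, one_mul, mul_add, mul_one,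
          Finset.mul_sum]
        have : ∑ l ∈ s, Matrix.single k i (x k) * Matrix.single l i (x l) = 0 := by
          refine Finset.sum_eq_zero fun l hl => ?_
          apply Matrix.single_mul_single_of_ne
          rintro rfl; exact hi.2 hl
        rw [this]; abel
      rw [e]
      exact mul_mem (Submonoid.subset_closure ⟨k, i, x k, Ne.symm hi.1, rfl⟩) (ih hi.2)
  have e : Matrix.vecMulVec x (Pi.single i 1) =
      ∑ k ∈ Finset.univ.erase i, Matrix.single k i (x k) := by
    ext a b
    rw [Matrix.sum_apply]
    simp only [Matrix.vecMulVec_apply, Pi.single_apply, Matrix.single_apply]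
    by_cases hb : b = i
    · subst hb
      by_cases ha : a = b
      · subst ha
        simp [hx]
      · simp [ha]
    · simp [hb, Ne.symm hb]
  rw [e]
  exact h _ (Finset.notMem_erase _ _)

lemma gt_mem (x : Fin n → R) (i : Fin n) (hx : x i = 0) : gt x i hx ∈ EU R n :=
  ⟨gt_closure x i hx, gt_closure (-x) i (by simp [hx])⟩

lemma rel_tau {i j c : Fin n} (hij : i ≠ j) (hic : i ≠ c) (hjc : j ≠ c)
    (x : Fin n → R) (hx : x i = 0) :
    gt x i hx * tu j c hjc 1 = tu j i hij.symm (-x c) * tu j c hjc 1 * gt x i hx := by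
  apply Units.ext
  simp only [Units.val_mul, gt, tu, Matrix.transvection]
  have hP : Matrix.vecMulVec x (Pi.single i 1) * Matrix.single j c (1 : R) = 0 := by
    ext a b
    rw [Matrix.mul_apply]
    refine Finset.sum_eq_zero fun k _ => ?_
    simp only [Matrix.vecMulVec_apply, Pi.single_apply, Matrix.single_apply]
    grind
  have hQ : ∀ (k : Fin n) (r : R), Matrix.single j k r * Matrix.vecMulVec x (Pi.single i 1)
      = Matrix.single j i (r * x k) := by
    intro k r
    ext a b
    simp only [Matrix.mul_apply, Matrix.vecMulVec_apply, Pi.single_apply, Matrix.single_apply]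
    by_cases ha : j = a <;> by_cases hb : i = b <;> simp [ha, hb, eq_comm]
  have hE : Matrix.single j i (-x c) * Matrix.single j c (1 : R) = 0 :=
    Matrix.single_mul_single_of_ne _ _ _ _ hij _
  simp only [mul_add, add_mul, one_mul, mul_one, hP, hQ, hE, zero_mul, hx, mul_zero,
    Matrix.single_zero, add_zero]
  have : Matrix.single j i (-x c) = - Matrix.single j i (x c) := by
    rw [← Matrix.single_neg]
  rw [this]; abel

lemma rel_comm {i j c : Fin n} (hic : i ≠ c) (hjc : j ≠ c) (r s : R) :
    tu i c hic r * tu j c hjc s = tu j c hjc s * tu i c hic r := by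
  apply Units.ext
  simp [tu, Matrix.transvection, mul_add, add_mul, Matrix.single_mul_single_of_ne, hic.symm,
    hjc.symm]
  abel

lemma rel_steinberg {i j c : Fin n} (hij : i ≠ j) (hic : i ≠ c) (hjc : j ≠ c) (r : R) :
    tu j i hij.symm r * tu i c hic 1 = tu j c hjc r * tu i c hic 1 * tu j i hij.symm r := by
  apply Units.ext
  simp [tu, Matrix.transvection, mul_add, add_mul, Matrix.single_mul_single_of_ne, hic.symm,
    hjc.symm]
  abel

lemma rel_left {i j k : Fin n} (hij : i ≠ j) (hik : i ≠ k) (hkj : k ≠ j) (r : R) :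
    (tu i k hik (-1) * tu k i hik.symm 1) * tu i j hij r =
      tu k j hkj r * (tu i k hik (-1) * tu k i hik.symm 1) := by
  apply Units.ext
  have e : ∀ (a b : Fin n) (s : R), Matrix.single a b (-s) = - Matrix.single a b s :=
    fun a b s => by rw [← Matrix.single_neg]
  simp [tu, Matrix.transvection, mul_add, add_mul, Matrix.single_mul_single_of_ne, hij,
    hkj, hik, hij.symm, hkj.symm, hik.symm, e]
  abel

lemma rel_right {i j l : Fin n} (hij : i ≠ j) (hil : i ≠ l) (hlj : l ≠ j) (r : R) :
    (tu l j hlj 1 * tu j l hlj.symm (-1)) * tu i j hij r =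
      tu i l hil r * (tu l j hlj 1 * tu j l hlj.symm (-1)) := by
  apply Units.ext
  have e : ∀ (a b : Fin n) (s : R), Matrix.single a b (-s) = - Matrix.single a b s :=
    fun a b s => by rw [← Matrix.single_neg]
  simp [tu, Matrix.transvection, mul_add, add_mul, Matrix.single_mul_single_of_ne, hij,
    hlj, hil, hij.symm, hlj.symm, hil.symm, e]
  try abel

/-- Products of at most `k` elementary conjugates of `G`. -/
def PC (G : (Matrix (Pair n) (Pair n) R)ˣ) (k : ℕ) (m : (Matrix (Pair n) (Pair n) R)ˣ) : Prop :=
  ∃ L : List (Matrix (Pair n) (Pair n) R)ˣ, L.length ≤ k ∧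
    (∀ x ∈ L, ∃ e ∈ EU R n, x = (phi R n e)⁻¹ * G * phi R n e ∨
      x = (phi R n e)⁻¹ * G⁻¹ * phi R n e) ∧ L.prod = m

lemma PC.mul {G m m' : (Matrix (Pair n) (Pair n) R)ˣ} {k k' : ℕ} (h : PC G k m)
    (h' : PC G k' m') : PC G (k + k') (m * m') := by
  obtain ⟨L, h1, h2, h3⟩ := h
  obtain ⟨L', h1', h2', h3'⟩ := h'
  refine ⟨L ++ L', by simp; omega, ?_, by simp [h3, h3']⟩
  intro x hx
  rcases List.mem_append.1 hx with hx | hx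
  · exact h2 x hx
  · exact h2' x hx

lemma PC.inv {G m : (Matrix (Pair n) (Pair n) R)ˣ} {k : ℕ} (h : PC G k m) : PC G k m⁻¹ := by
  obtain ⟨L, h1, h2, h3⟩ := h
  refine ⟨(L.map (·⁻¹)).reverse, by simpa using h1, ?_, by rw [← h3, List.prod_inv_reverse]⟩
  intro x hx
  simp only [List.mem_reverse, List.mem_map] at hx
  obtain ⟨y, hy, rfl⟩ := hx
  obtain ⟨e, he, h | h⟩ := h2 y hy
  · exact ⟨e, he, Or.inr (by rw [h]; group)⟩
  · exact ⟨e, he, Or.inl (by rw [h]; group)⟩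

lemma PC.conj {G m : (Matrix (Pair n) (Pair n) R)ˣ} {k : ℕ} (h : PC G k m)
    {e : (Matrix (Fin n) (Fin n) R)ˣ} (he : e ∈ EU R n) :
    PC G k (phi R n e * m * (phi R n e)⁻¹) := by
  obtain ⟨L, h1, h2, h3⟩ := h
  refine ⟨L.map (MulAut.conj (phi R n e)), by simpa using h1, ?_, ?_⟩
  · intro x hx
    simp only [List.mem_map] at hx
    obtain ⟨y, hy, rfl⟩ := hx
    obtain ⟨f, hf, h | h⟩ := h2 y hy
    · exact ⟨f * e⁻¹, mul_mem hf (inv_mem he), Or.inl (by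
        rw [h, MulAut.conj_apply, map_mul, map_inv]; group)⟩
    · exact ⟨f * e⁻¹, mul_mem hf (inv_mem he), Or.inr (by
        rw [h, MulAut.conj_apply, map_mul, map_inv]; group)⟩
  · rw [← map_list_prod, h3, MulAut.conj_apply]

lemma PC.base (G : (Matrix (Pair n) (Pair n) R)ˣ) : PC G 1 G :=
  ⟨[G], by simp, by
    intro x hx
    rw [List.mem_singleton] at hx
    exact ⟨1, one_mem _, Or.inl (by simp [hx])⟩, by simp⟩

lemma group_id {K : Type*} [Group K] (G T u v : K) (huv : v * u = u * v)
    (hc : v * ((G⁻¹ * T * G) * u * (G⁻¹ * T * G)⁻¹) =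
      ((G⁻¹ * T * G) * u * (G⁻¹ * T * G)⁻¹) * v) :
    (T * u * T⁻¹ * u⁻¹) * v * (T * u * T⁻¹ * u⁻¹)⁻¹ * v⁻¹ =
      (T * (u * (T⁻¹ * G⁻¹ * T * G) * u⁻¹ * (T⁻¹ * G⁻¹ * T * G)⁻¹) * T⁻¹) *
        (v * (T * (u * (T⁻¹ * G⁻¹ * T * G) * u⁻¹ * (T⁻¹ * G⁻¹ * T * G)⁻¹) * T⁻¹)⁻¹ * v⁻¹) := by
  generalize hξ : G⁻¹ * T * G = ξ at hc
  have hz : T⁻¹ * G⁻¹ * T * G = T⁻¹ * ξ := by rw [← hξ]; group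
  rw [hz]
  have ha : v * (u * (ξ * u * ξ⁻¹)⁻¹) = (u * (ξ * u * ξ⁻¹)⁻¹) * v := by
    have c1 : Commute v u := huv
    have c2 : Commute v (ξ * u * ξ⁻¹) := hc
    exact c1.mul_right c2.inv_right
  have hb : T * (u * (T⁻¹ * ξ) * u⁻¹ * (T⁻¹ * ξ)⁻¹) * T⁻¹ =
      (T * u * T⁻¹ * u⁻¹) * (u * (ξ * u * ξ⁻¹)⁻¹) := by group
  rw [hb]
  generalize u * (ξ * u * ξ⁻¹)⁻¹ = a at ha
  generalize T * u * T⁻¹ * u⁻¹ = b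
  have : a * v * a⁻¹ = v := by rw [← ha]; group
  calc b * v * b⁻¹ * v⁻¹ = b * (a * v * a⁻¹) * b⁻¹ * v⁻¹ := by rw [this]
    _ = _ := by group

lemma eight {G : (Matrix (Pair n) (Pair n) R)ˣ} (hG : Good G.val) {i j c : Fin n} (hij : i ≠ j)
    (hic : i ≠ c) (hjc : j ≠ c) :
    PC G 8 (phi R n (tu j c hjc (- sk (G.val *ᵥ ev R i j) i c))) := by
  set w := G.val *ᵥ ev R i j with hw
  set τ := gt (fun p => sk w i p) i (sk_self w i) with hτ
  have hτm : τ ∈ EU R n := gt_mem _ _ _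
  set T := phi R n τ with hT
  have hTw : T.val *ᵥ w = w := by
    apply sk_ext
    intro a b
    rw [hT, phi_val, sk_act τ.val (fun p => sk w i p) i]
    · rw [sk_swap w a i]; ring
    · intro a p
      simp [hτ, gt, Matrix.add_apply, Matrix.one_apply, Matrix.vecMulVec_apply, Pi.single_apply,
        eq_comm]
  set ξ := G⁻¹ * T * G with hξ
  have hGi : Good (G⁻¹).val := hG.inv (by simp)
  have hTg : Good T.val := good_ext2 _
  have hTi : Good (T⁻¹).val := hTg.inv (by simp)
  have hξg : Good ξ.val := by
    rw [hξ, Units.val_mul, Units.val_mul]; exact (hGi.mul hTg).mul hG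
  have hξi : Good (ξ⁻¹).val := hξg.inv (by simp)
  have hξe : ξ.val *ᵥ ev R i j = ev R i j := by
    rw [hξ, Units.val_mul, Units.val_mul, ← Matrix.mulVec_mulVec, ← Matrix.mulVec_mulVec, ← hw, hTw,
      hw, Matrix.mulVec_mulVec, ← Units.val_mul, inv_mul_cancel, Units.val_one, Matrix.one_mulVec]
  set u := tu j c hjc (1 : R) with hu
  set v := tu i c hic (1 : R) with hv
  have hum : u ∈ EU R n := tu_mem _ _ _ _
  have hvm : v ∈ EU R n := tu_mem _ _ _ _
  have hc : phi R n v * (ξ * phi R n u * ξ⁻¹) = (ξ * phi R n u * ξ⁻¹) * phi R n v := by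
    apply Units.ext
    simp only [Units.val_mul]
    exact comm_main hij hic hjc hξg hξi (by simp) (by simp) hξe
  have huv : phi R n v * phi R n u = phi R n u * phi R n v := by
    rw [← map_mul, ← map_mul, hu, hv, rel_comm]
  have hid := group_id G T (phi R n u) (phi R n v) huv hc
  have b1 : τ * u * τ⁻¹ * u⁻¹ = tu j i hij.symm (-sk w i c) := by
    rw [hτ, hu, rel_tau hij hic hjc]; group
  have b2 : tu j i hij.symm (-sk w i c) * v * (tu j i hij.symm (-sk w i c))⁻¹ * v⁻¹ =
      tu j c hjc (-sk w i c) := by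
    rw [hv, rel_steinberg hij hic hjc]; group
  have hl : phi R n (tu j c hjc (-sk w i c)) =
      (T * phi R n u * T⁻¹ * (phi R n u)⁻¹) * phi R n v *
        (T * phi R n u * T⁻¹ * (phi R n u)⁻¹)⁻¹ * (phi R n v)⁻¹ := by
    rw [← b2, ← b1, hT]; simp only [map_mul, map_inv]
  rw [hl, hid]
  have p2 : PC G 2 (T⁻¹ * G⁻¹ * T * G) := by
    have := ((PC.base G).inv.conj (inv_mem hτm)).mul (PC.base G)
    simpa only [map_inv, inv_inv, ← hT] using this
  have p4 : PC G 4 (T * (phi R n u * (T⁻¹ * G⁻¹ * T * G) * (phi R n u)⁻¹ *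
      (T⁻¹ * G⁻¹ * T * G)⁻¹) * T⁻¹) := ((p2.conj hum).mul p2.inv).conj hτm
  exact p4.mul (p4.inv.conj hvm)

lemma move_left {G : (Matrix (Pair n) (Pair n) R)ˣ} {m : ℕ} {i j k : Fin n} (hij : i ≠ j)
    (hkj : k ≠ j) {r : R} (h : PC G m (phi R n (tu i j hij r))) :
    PC G m (phi R n (tu k j hkj r)) := by
  by_cases hik : i = k
  · subst hik; exact h
  have := h.conj (mul_mem (tu_mem i k hik (-1)) (tu_mem k i (Ne.symm hik) (1 : R)))
  rw [← map_mul, rel_left hij hik hkj, map_mul, mul_inv_cancel_right] at this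
  exact this

lemma move_right {G : (Matrix (Pair n) (Pair n) R)ˣ} {m : ℕ} {i j l : Fin n} (hij : i ≠ j)
    (hil : i ≠ l) {r : R} (h : PC G m (phi R n (tu i j hij r))) :
    PC G m (phi R n (tu i l hil r)) := by
  by_cases hlj : l = j
  · subst hlj; exact h
  have := h.conj (mul_mem (tu_mem l j hlj (1 : R)) (tu_mem j l (Ne.symm hlj) (-1)))
  rw [← map_mul, rel_right hij hil hlj, map_mul, mul_inv_cancel_right] at this
  exact this

lemma move {G : (Matrix (Pair n) (Pair n) R)ˣ} (hn : 4 ≤ n) {m : ℕ} {i j k l : Fin n} (hij : i ≠ j)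
    (hkl : k ≠ l) {r : R} (h : PC G m (phi R n (tu i j hij r))) :
    PC G m (phi R n (tu k l hkl r)) := by
  have step : ∀ {i : Fin n} (hij : i ≠ j), PC G m (phi R n (tu i j hij r)) → i ≠ l →
      PC G m (phi R n (tu k l hkl r)) :=
    fun hij h hil => move_left hil hkl (move_right hij hil h)
  by_cases hil : i = l
  · obtain ⟨t, ht⟩ : ∃ t : Fin n, t ∉ ({j, l} : Finset (Fin n)) := by
      by_contra! hcon
      have h1 : (Finset.univ : Finset (Fin n)) ⊆ {j, l} := fun t _ => hcon t
      have h2 := Finset.card_le_card h1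
      have h3 := Finset.card_le_two (a := j) (b := l)
      simp at h2
      omega
    simp only [Finset.mem_insert, Finset.mem_singleton, not_or] at ht
    exact step ht.1 (move_left hij ht.1 h) ht.2
  · exact step hij h hil

lemma PC.final {G : (Matrix (Pair n) (Pair n) R)ˣ} {k : ℕ} {m : (Matrix (Pair n) (Pair n) R)ˣ}
    (h : PC G k m) : ∃ L : List (Matrix (Pair n) (Pair n) R), L.length ≤ k ∧
      (∀ m ∈ L, IsElemConj G.val (G⁻¹).val m) ∧ L.prod = m.val := by
  obtain ⟨L, h1, h2, h3⟩ := h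
  refine ⟨L.map (Units.coeHom _), by simpa using h1, ?_, ?_⟩
  · intro x hx
    simp only [List.mem_map] at hx
    obtain ⟨y, hy, rfl⟩ := hx
    obtain ⟨e, he, h⟩ := h2 y hy
    refine ⟨(phi R n e).val, ((phi R n e)⁻¹).val, ⟨e.val, he.1, rfl⟩, by simp, by simp, ?_⟩
    rcases h with h | h
    · left; rw [h]; rfl
    · right; rw [h]; rfl
  · rw [← map_list_prod, h3]; rfl

lemma PC.sign {G : (Matrix (Pair n) (Pair n) R)ˣ} {m : ℕ} {i j : Fin n} (hij : i ≠ j) {r : R}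
    (h : PC G m (phi R n (tu i j hij (-r)))) : PC G m (phi R n (tu i j hij r)) := by
  have := h.inv
  rw [← map_inv] at this
  have e : (tu i j hij (-r))⁻¹ = tu i j hij r := by
    apply Units.ext
    change Matrix.transvection i j (- -r) = Matrix.transvection i j r
    rw [neg_neg]
  rwa [e] at this

end groups

/-- Reverse decomposition of unipotents, statement (1) of the main theorem:
for `g ∈ ⋀²GL_n(R)`, `n ≥ 4`, any entry `g_{I,J}` with `|I ∩ J| = 1` and any `k ≠ l`,
the exterior transvection `⋀²t_{k,l}(g_{I,J})` is a product of at most `8` elementary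
exterior conjugates of `g` and `g⁻¹`. -/
theorem stmt19 {R : Type*} [CommRing R] {n : ℕ} (hn : 4 ≤ n)
    (g g' : Matrix (Pair n) (Pair n) R) (hg : MemExtGL g g')
    (I J : Pair n) (hIJ : I ≠ J) (hmeet : meets I J)
    (k l : Fin n) (hkl : k ≠ l) :
    ∃ L : List (Matrix (Pair n) (Pair n) R), L.length ≤ 8 ∧
      (∀ m ∈ L, IsElemConj g g' m) ∧
      L.prod = ext2 (Matrix.transvection k l (g I J)) := by
  let G : (Matrix (Pair n) (Pair n) R)ˣ := ⟨g, g', hg.mul_inv, hg.inv_mul⟩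
  have hG : Good G.val := hg.good
  suffices h : PC G 8 (phi R n (tu k l hkl (g I J))) from h.final
  have main : ∀ i j c : Fin n, i ≠ j → i ≠ c → j ≠ c →
      (g I J = sk (g *ᵥ ev R i j) i c ∨ g I J = - sk (g *ᵥ ev R i j) i c) →
      PC G 8 (phi R n (tu k l hkl (g I J))) := by
    intro i j c hij hic hjc h
    have h8 := eight hG hij hic hjc
    have h8' := move hn hjc hkl h8
    rcases h with h | h
    · rw [h]; exact PC.sign hkl h8'
    · rw [h]; exact h8'
  have hcol : g *ᵥ ev R J.1.1 J.1.2 = fun P => g P J := by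
    rw [ev_pair, Matrix.mulVec_single_one]; rfl
  have hcol' : g *ᵥ ev R J.1.2 J.1.1 = - fun P => g P J := by
    rw [ev_swap, Matrix.mulVec_neg, hcol]
  have hI : sk (fun P => g P J) I.1.1 I.1.2 = g I J := sk_pair _ I
  have hI' : sk (fun P => g P J) I.1.2 I.1.1 = - g I J := by rw [sk_swap, hI]
  have hIlt := I.2
  have hJlt := J.2
  have hne : ¬ (I.1.1 = J.1.1 ∧ I.1.2 = J.1.2) := fun h => hIJ (Subtype.ext (Prod.ext h.1 h.2))
  rcases hmeet with h | h | h | h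
  · refine main J.1.1 J.1.2 I.1.2 hJlt.ne (h ▸ hIlt.ne) (fun h' => hne ⟨h, h'.symm⟩) (Or.inl ?_)
    rw [hcol, ← h, hI]
  · refine main J.1.2 J.1.1 I.1.2 hJlt.ne' (h ▸ hIlt.ne) ?_ (Or.inr ?_)
    · exact (hJlt.trans (h ▸ hIlt)).ne
    · rw [hcol', sk_neg, ← h, hI, neg_neg]
  · refine main J.1.1 J.1.2 I.1.1 hJlt.ne (h ▸ hIlt.ne') ?_ (Or.inr ?_)
    · exact ((h ▸ hIlt : I.1.1 < J.1.1).trans hJlt).ne'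
    · rw [hcol, ← h, hI', neg_neg]
  · refine main J.1.2 J.1.1 I.1.1 hJlt.ne' (h ▸ hIlt.ne') (fun h' => hne ⟨h'.symm, h⟩) (Or.inl ?_)
    rw [hcol', sk_neg, ← h, hI', neg_neg]
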